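/- If p is an odd prime, then AT(p) ≡ (−1)^{(p−1)/2} (mod p). -/

import Mathlib

/-- `L` is a Latin square of order `n`: every row and every column is a
bijection of `Fin n` (i.e. contains each symbol exactly once). -/
def IsLatin {n : ℕ} (L : Fin n → Fin n → Fin n) : Prop :=
  (∀ i, Function.Bijective fun j => L i j) ∧ ∀ j, Function.Bijective fun i => L i j

/-- The permutation determined by a bijective function (junk value `1` otherwise). -/
noncomputable def permOf {n : ℕ} (f : Fin n → Fin n) : Equiv.Perm (Fin n) :=
  if h : Function.Bijective f then Equiv.ofBijective f h else 1

/-- The product of the signs of the rows of `L`. -/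
noncomputable def rowSign {n : ℕ} (L : Fin n → Fin n → Fin n) : ℤ :=
  ∏ i, (Equiv.Perm.sign (permOf fun j => L i j) : ℤ)

/-- The product of the signs of the columns of `L`. -/
noncomputable def colSign {n : ℕ} (L : Fin n → Fin n → Fin n) : ℤ :=
  ∏ j, (Equiv.Perm.sign (permOf fun i => L i j) : ℤ)

/-- The sign of a Latin square: row-sign times column-sign. -/
noncomputable def latinSign {n : ℕ} (L : Fin n → Fin n → Fin n) : ℤ :=
  rowSign L * colSign L

/-- The permutation `α_s` of a Latin square `L`: `α_s i = j` iff `L i j = s`. -/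
noncomputable def symPerm {n : ℕ} (L : Fin n → Fin n → Fin n) (s : Fin n) :
    Equiv.Perm (Fin n) :=
  permOf fun i => (permOf fun j => L i j).symm s

/-- The symbol-sign of a Latin square: the product of the signs of the `α_s`. -/
noncomputable def symbolSign {n : ℕ} (L : Fin n → Fin n → Fin n) : ℤ :=
  ∏ s, (Equiv.Perm.sign (symPerm L s) : ℤ)

/-- The number of Latin squares of order `n`. -/
noncomputable def numLatin (n : ℕ) : ℕ :=
  Nat.card {L : Fin n → Fin n → Fin n // IsLatin L}

/-- The number of even Latin squares of order `n`. -/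
noncomputable def numLatinEven (n : ℕ) : ℕ :=
  Nat.card {L : Fin n → Fin n → Fin n // IsLatin L ∧ latinSign L = 1}

/-- The number of odd Latin squares of order `n`. -/
noncomputable def numLatinOdd (n : ℕ) : ℕ :=
  Nat.card {L : Fin n → Fin n → Fin n // IsLatin L ∧ latinSign L = -1}

/-- `L` is normalized: its first row is the identity permutation. -/
def IsNormalized {n : ℕ} (L : Fin n → Fin n → Fin n) : Prop :=
  ∀ j : Fin n, L ⟨0, j.pos⟩ j = j

/-- `L` is unipotent: all entries on the main diagonal are equal. -/
def IsUnipotent {n : ℕ} (L : Fin n → Fin n → Fin n) : Prop :=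
  ∀ i k : Fin n, L i i = L k k

/-- The Alon-Tarsi constant `AT(n) = U_n^E - U_n^O`. -/
noncomputable def AT (n : ℕ) : ℤ :=
  (Nat.card {L : Fin n → Fin n → Fin n //
      IsLatin L ∧ IsNormalized L ∧ IsUnipotent L ∧ latinSign L = 1} : ℤ) -
  (Nat.card {L : Fin n → Fin n → Fin n //
      IsLatin L ∧ IsNormalized L ∧ IsUnipotent L ∧ latinSign L = -1} : ℤ)

/-- `L` is reduced: first row and first column are the identity. -/
def IsReducedLatin {n : ℕ} (L : Fin n → Fin n → Fin n) : Prop :=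
  IsNormalized L ∧ ∀ i : Fin n, L i ⟨0, i.pos⟩ = i

/-- The number of even reduced Latin squares of order `n`. -/
noncomputable def numReducedEven (n : ℕ) : ℕ :=
  Nat.card {L : Fin n → Fin n → Fin n // IsLatin L ∧ IsReducedLatin L ∧ latinSign L = 1}

/-- The number of odd reduced Latin squares of order `n`. -/
noncomputable def numReducedOdd (n : ℕ) : ℕ :=
  Nat.card {L : Fin n → Fin n → Fin n // IsLatin L ∧ IsReducedLatin L ∧ latinSign L = -1}

/-- `L_n^SE(π)`: Latin squares whose permutation `α₁` (of the first symbol)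
is `π` and whose symbol-sign is `+1`. The first symbol is the element of
`Fin n` with value `0`, and `α₁ = π` is expressed by `L i (π i) = first symbol`. -/
noncomputable def numSymEven (n : ℕ) (π : Equiv.Perm (Fin n)) : ℕ :=
  Nat.card {L : Fin n → Fin n → Fin n //
    IsLatin L ∧ (∀ i, (L i (π i)).val = 0) ∧ symbolSign L = 1}

/-- `L_n^SO(π)`: as `numSymEven` but with symbol-sign `-1`. -/
noncomputable def numSymOdd (n : ℕ) (π : Equiv.Perm (Fin n)) : ℕ :=
  Nat.card {L : Fin n → Fin n → Fin n //
    IsLatin L ∧ (∀ i, (L i (π i)).val = 0) ∧ symbolSign L = -1}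

/-- `L_n^CE(π)`: column-even Latin squares with first column `π`. -/
noncomputable def numColEven (n : ℕ) (π : Equiv.Perm (Fin n)) : ℕ :=
  Nat.card {L : Fin n → Fin n → Fin n //
    IsLatin L ∧ (∀ i : Fin n, L i ⟨0, i.pos⟩ = π i) ∧ colSign L = 1}

/-- `L_n^CO(π)`: column-odd Latin squares with first column `π`. -/
noncomputable def numColOdd (n : ℕ) (π : Equiv.Perm (Fin n)) : ℕ :=
  Nat.card {L : Fin n → Fin n → Fin n //
    IsLatin L ∧ (∀ i : Fin n, L i ⟨0, i.pos⟩ = π i) ∧ colSign L = -1}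

/-- `L_n^CE(α, β)`: column-even Latin squares with first row `α` and first column `β`. -/
noncomputable def numColEven₂ (n : ℕ) (α β : Equiv.Perm (Fin n)) : ℕ :=
  Nat.card {L : Fin n → Fin n → Fin n //
    IsLatin L ∧ (∀ j : Fin n, L ⟨0, j.pos⟩ j = α j) ∧
      (∀ i : Fin n, L i ⟨0, i.pos⟩ = β i) ∧ colSign L = 1}

/-- `L_n^CO(α, β)`: column-odd Latin squares with first row `α` and first column `β`. -/
noncomputable def numColOdd₂ (n : ℕ) (α β : Equiv.Perm (Fin n)) : ℕ :=
  Nat.card {L : Fin n → Fin n → Fin n //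
    IsLatin L ∧ (∀ j : Fin n, L ⟨0, j.pos⟩ j = α j) ∧
      (∀ i : Fin n, L i ⟨0, i.pos⟩ = β i) ∧ colSign L = -1}

/-- The `n × n` matrix of indeterminates, over `ℤ`. -/
noncomputable def Xmat (n : ℕ) :
    Matrix (Fin n) (Fin n) (MvPolynomial (Fin n × Fin n) ℤ) :=
  Matrix.of fun i j => MvPolynomial.X (i, j)

/-- The exponent vector of the square-free monomial `∏_{i,j} X i j`. -/
noncomputable def allOnes (n : ℕ) : (Fin n × Fin n) →₀ ℕ :=
  Finsupp.equivFunOnFinite.symm fun _ => 1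

/-- The `(0,1)`-matrix (over `ℤ`) associated to a Boolean matrix. -/
def toInt {n : ℕ} (A : Fin n → Fin n → Bool) : Matrix (Fin n) (Fin n) ℤ :=
  Matrix.of fun i j => if A i j then 1 else 0

/-- `σ₀(A)`: the number of zero entries of a `(0,1)`-matrix. -/
def sigma0 {n : ℕ} (A : Fin n → Fin n → Bool) : ℕ :=
  (Finset.univ.filter fun p : Fin n × Fin n => A p.1 p.2 = false).card

lemma permOf_coe {n : ℕ} (σ : Equiv.Perm (Fin n)) : permOf (fun j => σ j) = σ := by
  ext j
  simp [permOf]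

lemma permOf_apply {n : ℕ} {f : Fin n → Fin n} (hf : Function.Bijective f) (j : Fin n) :
    permOf f j = f j := by
  rw [permOf, dif_pos hf, Equiv.ofBijective_apply]

/-- Applying an isotopism to a Latin square multiplies its row-sign by a power of the signs of
the symbol and column permutations. -/
lemma rowSign_isotopic {n : ℕ} {L : Fin n → Fin n → Fin n}
    (hL : ∀ i, Function.Bijective fun j => L i j) (r c s : Equiv.Perm (Fin n)) :
    rowSign (fun i j => s (L (r i) (c j))) =
      ((s.sign : ℤ) * (c.sign : ℤ)) ^ n * rowSign L := by
  have h (i : Fin n) : permOf (fun j => s (L (r i) (c j))) =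
      s * permOf (fun j => L (r i) j) * c := by
    rw [← permOf_coe (s * permOf (fun j => L (r i) j) * c)]
    congr 1
    funext j
    simp [permOf_apply (hL (r i))]
  simp only [rowSign, h, Equiv.Perm.sign_mul, Units.val_mul]
  rw [← Equiv.prod_comp r (fun i => ((permOf fun j => L i j).sign : ℤ)),
    Finset.prod_mul_distrib, Finset.prod_mul_distrib]
  simp only [Finset.prod_const, Finset.card_univ, Fintype.card_fin]
  ring

/-- Permuting the symbols, and permuting rows and columns by the same permutation, preserves the
sign of a Latin square. -/
lemma latinSign_isotopic {n : ℕ} {L : Fin n → Fin n → Fin n} (hL : IsLatin L)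
    (r s : Equiv.Perm (Fin n)) :
    latinSign (fun i j => s (L (r i) (r j))) = latinSign L := by
  have hc : colSign (fun i j => s (L (r i) (r j))) =
      ((s.sign : ℤ) * (r.sign : ℤ)) ^ n * colSign L :=
    rowSign_isotopic (L := fun i j => L j i) hL.2 r r s
  have hsq : ((s.sign : ℤ) * (r.sign : ℤ)) ^ n * ((s.sign : ℤ) * (r.sign : ℤ)) ^ n = 1 := by
    rw [← mul_pow, ← Units.val_mul, ← Units.val_mul, Int.units_mul_self, Units.val_one, one_pow]
  rw [latinSign, rowSign_isotopic hL.1, hc, latinSign]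
  linear_combination rowSign L * colSign L * hsq

lemma IsLatin.isotopic {n : ℕ} {L : Fin n → Fin n → Fin n} (hL : IsLatin L)
    (r c s : Equiv.Perm (Fin n)) : IsLatin (fun i j => s (L (r i) (c j))) :=
  ⟨fun i => s.bijective.comp ((hL.1 (r i)).comp c.bijective),
    fun j => s.bijective.comp ((hL.2 (c j)).comp r.bijective)⟩

/-- The normalized unipotent Latin squares of order `n` and sign `e`. -/
abbrev UnipotentSquare (n : ℕ) (e : ℤ) : Type :=
  {L : Fin n → Fin n → Fin n //
    IsLatin L ∧ IsNormalized L ∧ IsUnipotent L ∧ latinSign L = e}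

namespace UnipotentSquare

variable {n : ℕ} [NeZero n] {e : ℤ}

lemma apply_zero (L : UnipotentSquare n e) (j : Fin n) : L.1 0 j = j := L.2.2.1 j

lemma apply_self (L : UnipotentSquare n e) (i : Fin n) : L.1 i i = 0 :=
  (L.2.2.2.1 i 0).trans (L.apply_zero 0)

/-- The `k`-th row of `L`, read cyclically from the diagonal entry on. -/
noncomputable def diagRow (L : UnipotentSquare n e) (k : Fin n) : Equiv.Perm (Fin n) :=
  (Equiv.addRight k).trans (permOf fun j => L.1 k j)

lemma diagRow_apply (L : UnipotentSquare n e) (k j : Fin n) :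
    L.diagRow k j = L.1 k (j + k) := by
  simp [diagRow, permOf_apply (L.2.1.1 k)]

/-- Shift the rows and columns of `L` cyclically by `k`, then rename the symbols so that the
first row is the identity again. -/
noncomputable def shift (k : Fin n) (L : UnipotentSquare n e) : UnipotentSquare n e :=
  ⟨fun i j => (L.diagRow k).symm (L.1 (i + k) (j + k)),
    L.2.1.isotopic (Equiv.addRight k) (Equiv.addRight k) (L.diagRow k).symm,
    fun j => by
      rw [Equiv.symm_apply_eq, diagRow_apply]
      exact congrArg (L.1 · (j + k)) (zero_add k),
    fun i j => by simp only [apply_self],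
    (latinSign_isotopic L.2.1 (Equiv.addRight k) (L.diagRow k).symm).trans L.2.2.2.2⟩

lemma shift_apply (k : Fin n) (L : UnipotentSquare n e) (i j : Fin n) :
    (shift k L).1 i j = (L.diagRow k).symm (L.1 (i + k) (j + k)) := rfl

lemma diagRow_shift (k l : Fin n) (L : UnipotentSquare n e) :
    (shift k L).diagRow l = (L.diagRow (l + k)).trans (L.diagRow k).symm := by
  ext1 j
  simp [diagRow_apply, shift_apply, add_assoc]

noncomputable instance : MulAction (Multiplicative (Fin n)) (UnipotentSquare n e) where
  smul k L := shift k.toAdd L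
  one_smul L := by
    refine Subtype.ext (funext₂ fun i j => ?_)
    change (shift 0 L).1 i j = _
    rw [shift_apply, Equiv.symm_apply_eq, diagRow_apply, apply_zero]
    simp
  mul_smul k l L := by
    refine Subtype.ext (funext₂ fun i j => ?_)
    change (shift (k.toAdd + l.toAdd) L).1 i j = (shift k.toAdd (shift l.toAdd L)).1 i j
    simp [shift_apply, diagRow_shift, add_assoc]

lemma smul_eq_shift (k : Fin n) (L : UnipotentSquare n e) :
    Multiplicative.ofAdd k • L = shift k L := rfl

end UnipotentSquare

/-- A permutation of a set of prime size `p` whose `p`-th power is trivial is trivial as soon as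
it has a fixed point. -/
lemma Equiv.Perm.eq_one_of_pow_card_eq_one {α : Type*} [Fintype α] {σ : Equiv.Perm α}
    (hp : (Fintype.card α).Prime) (hσ : σ ^ Fintype.card α = 1) {a : α} (ha : σ a = a) :
    σ = 1 := by
  classical
  rcases (Nat.dvd_prime hp).1 (orderOf_dvd_of_pow_eq_one hσ) with h | h
  · exact orderOf_eq_one_iff.1 h
  · have hs : σ.support = Finset.univ :=
      Finset.eq_univ_of_card _ ((isCycle_of_prime_order'' hp h).orderOf.symm.trans h)
    exact absurd ha (Equiv.Perm.mem_support.1 (hs ▸ Finset.mem_univ a))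

lemma UnipotentSquare.eq_sub_of_mem_fixedPoints {p : ℕ} [Fact p.Prime] {e : ℤ}
    {L : UnipotentSquare p e}
    (hL : L ∈ MulAction.fixedPoints (Multiplicative (Fin p)) (UnipotentSquare p e))
    (i j : Fin p) : L.1 i j = j - i := by
  have hfix (k i j : Fin p) : L.1 (i + k) (j + k) = L.diagRow k (L.1 i j) := by
    have h := congrArg (fun M : UnipotentSquare p e => M.1 i j) (hL (Multiplicative.ofAdd k))
    simpa only [smul_eq_shift, shift_apply, Equiv.symm_apply_eq] using h
  have hadd (k l : Fin p) : L.diagRow (l + k) = L.diagRow k * L.diagRow l := by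
    ext1 j
    rw [Equiv.Perm.mul_apply, diagRow_apply L l, ← hfix, diagRow_apply, add_assoc]
  have hzero : L.diagRow 0 = 1 := by
    ext1 j
    simp [diagRow_apply, apply_zero]
  have hpow (k : Fin p) (m : ℕ) : L.diagRow (m • k) = L.diagRow k ^ m := by
    induction m with
    | zero => simp [hzero]
    | succ m ih => rw [succ_nsmul, hadd, ih, pow_succ']
  have hone : L.diagRow i = 1 := by
    refine Equiv.Perm.eq_one_of_pow_card_eq_one (a := 0) ?_ ?_ ?_
    · simpa using Fact.out (p := p.Prime)
    · rw [← hpow, card_nsmul_eq_zero, hzero]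
    · simp [diagRow_apply, apply_self]
  simpa [hone, apply_zero] using hfix i 0 (j - i)

/-- The cyclic unipotent square of order `n`. -/
def cyclicSquare (n : ℕ) (i j : Fin n) : Fin n := j - i

section cyclicSquare

variable {n : ℕ} [NeZero n]

lemma isLatin_cyclicSquare : IsLatin (cyclicSquare n) :=
  ⟨fun i => (Equiv.subRight i).bijective, fun j => (Equiv.subLeft j).bijective⟩

lemma isNormalized_cyclicSquare : IsNormalized (cyclicSquare n) :=
  fun j => sub_zero j

lemma isUnipotent_cyclicSquare : IsUnipotent (cyclicSquare n) :=
  fun i k => (sub_self i).trans (sub_self k).symm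

lemma sign_subRight_of_odd (hn : Odd n) (i : Fin n) : Equiv.Perm.sign (Equiv.subRight i) = 1 := by
  have hpow (m : ℕ) (j : Fin n) : (Equiv.subRight i ^ m : Equiv.Perm (Fin n)) j = j - m • i := by
    induction m with
    | zero => simp
    | succ m ih => simp [pow_succ', ih, succ_nsmul, sub_sub]
  have h : (Equiv.subRight i ^ n : Equiv.Perm (Fin n)) = 1 := by
    ext1 j
    have hi : n • i = 0 := by simpa using card_nsmul_eq_zero (x := i)
    simp only [hpow, hi, sub_zero, Equiv.Perm.one_apply]
  have h' := congrArg Equiv.Perm.sign h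
  obtain ⟨k, hk⟩ := hn
  rwa [map_pow, map_one, show ∀ u : ℤˣ, u ^ n = u by
    intro u; rw [hk, pow_succ, pow_mul, Int.units_sq, one_pow, one_mul]] at h'

lemma sign_neg_of_odd (hn : Odd n) : Equiv.Perm.sign (Equiv.neg (Fin n)) = (-1) ^ ((n - 1) / 2) := by
  have hfix : Function.fixedPoints (Equiv.neg (Fin n)) = {0} := by
    ext i
    simp only [Function.mem_fixedPoints, Function.IsFixedPt, Equiv.neg_apply,
      Set.mem_singleton_iff]
    refine ⟨fun h => ?_, fun h => by simp [h]⟩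
    obtain ⟨k, hk⟩ := hn
    have hi : n • i = 0 := by simpa using card_nsmul_eq_zero (x := i)
    have h2 : 2 • i = 0 := by rw [two_nsmul]; nth_rw 1 [← h]; exact neg_add_cancel i
    rwa [show n • i = k • 2 • i + i by rw [← mul_nsmul', mul_comm, ← succ_nsmul, ← hk], h2,
      nsmul_zero, zero_add] at hi
  rw [Equiv.Perm.sign_of_pow_two_eq_one (by ext1 i; simp [pow_two])]
  rw [← Nat.card_eq_fintype_card, ← Nat.card_eq_fintype_card, hfix]
  simp

lemma latinSign_cyclicSquare (hn : Odd n) : latinSign (cyclicSquare n) = (-1) ^ ((n - 1) / 2) := by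
  have hrow (i : Fin n) : (permOf fun j => cyclicSquare n i j).sign = 1 := by
    rw [← sign_subRight_of_odd hn i, ← permOf_coe (Equiv.subRight i)]
    rfl
  have hcol (j : Fin n) :
      (permOf fun i => cyclicSquare n i j).sign = (-1) ^ ((n - 1) / 2) := by
    rw [← sign_neg_of_odd hn, ← mul_one (Equiv.Perm.sign (Equiv.neg (Fin n))), ← sign_subRight_of_odd hn j,
      ← Equiv.Perm.sign_mul, ← permOf_coe (Equiv.neg (Fin n) * Equiv.subRight j)]
    congr 2
    funext i
    simp [cyclicSquare]
  simp only [latinSign, rowSign, colSign, hrow, hcol]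
  simp only [Units.val_one, Finset.prod_const_one, Finset.prod_const, Finset.card_univ,
    Fintype.card_fin, one_mul, Units.val_pow_eq_pow_val, Units.val_neg]
  rw [pow_right_comm, hn.neg_one_pow]

end cyclicSquare

lemma UnipotentSquare.card_modEq {p : ℕ} [Fact p.Prime] (e : ℤ) :
    Nat.card (UnipotentSquare p e) ≡
      if latinSign (cyclicSquare p) = e then 1 else 0 [MOD p] := by
  have hG : IsPGroup p (Multiplicative (Fin p)) := IsPGroup.of_card (n := 1) (by simp)
  have hmod := hG.card_modEq_card_fixedPoints (UnipotentSquare p e)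
  have heq (L : MulAction.fixedPoints (Multiplicative (Fin p)) (UnipotentSquare p e)) :
      L.1.1 = cyclicSquare p := funext₂ (eq_sub_of_mem_fixedPoints L.2)
  suffices h : Nat.card (MulAction.fixedPoints (Multiplicative (Fin p)) (UnipotentSquare p e)) =
      if latinSign (cyclicSquare p) = e then 1 else 0 by rwa [h] at hmod
  split_ifs with h
  · let C : UnipotentSquare p e :=
      ⟨cyclicSquare p, isLatin_cyclicSquare, isNormalized_cyclicSquare,
        isUnipotent_cyclicSquare, h⟩
    have hC : C ∈ MulAction.fixedPoints (Multiplicative (Fin p)) (UnipotentSquare p e) := by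
      refine fun k => Subtype.ext (funext₂ fun i j => ?_)
      change (shift k.toAdd C).1 i j = _
      rw [shift_apply, Equiv.symm_apply_eq, diagRow_apply]
      simp [C, cyclicSquare]
    exact Nat.card_eq_one_iff_exists.2
      ⟨⟨C, hC⟩, fun L => Subtype.ext (Subtype.ext (heq L))⟩
  · rw [Nat.card_eq_zero]
    exact Or.inl ⟨fun L => h (heq L ▸ L.1.2.2.2.2)⟩

/-- **Drisko.** If `p` is an odd prime, then `AT(p) ≡ (-1)^{(p-1)/2} (mod p)`. -/
theorem AT_prime_mod (p : ℕ) (hp : p.Prime) (hodd : Odd p) :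
    AT p ≡ (-1) ^ ((p - 1) / 2) [ZMOD (p : ℤ)] := by
  have : Fact p.Prime := ⟨hp⟩
  have h := ((Int.natCast_modEq_iff.2 (UnipotentSquare.card_modEq (p := p) 1)).sub
    (Int.natCast_modEq_iff.2 (UnipotentSquare.card_modEq (p := p) (-1))))
  rw [latinSign_cyclicSquare hodd] at h
  rcases neg_one_pow_eq_or ℤ ((p - 1) / 2) with hs | hs <;> simpa [hs, AT] using h
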